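/- Assume that for every prime ideal p of A, the largest invariant ideal p* = {x ∈ p : ψ(x) ∈ p ⊗ H} contained in p is again a prime ideal. Then the assignment p ↦ p* defines a continuous map r : Spec(A) → Spec^inv(A) which restricts to the identity on Spec^inv(A) (so r is a continuous retraction); moreover, for every invariant ideal I of A, r⁻¹(V^inv(I)) = V(I), the Zariski-closed set of primes containing I. -/

import Mathlib

open TensorProduct

variable (k : Type*) [Field k]
variable (A : Type*) [CommRing A] [Algebra k A]
variable (H : Type*) [Ring H] [HopfAlgebra k H]

/-- The image `I ⊗ H` of the canonical map `I ⊗[k] H → A ⊗[k] H`, for an ideal `I` of `A`. -/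
noncomputable def idealTensor (I : Ideal A) : Submodule k (A ⊗[k] H) :=
  LinearMap.range (TensorProduct.map ((I.restrictScalars k).subtype)
    (LinearMap.id : H →ₗ[k] H))

/-- An ideal `I` of `A` is invariant (for the coaction `ψ : A → A ⊗[k] H`) if
`ψ x ∈ I ⊗ H` for all `x ∈ I`. -/
def IsInvariantIdeal (ψ : A →ₐ[k] A ⊗[k] H) (I : Ideal A) : Prop :=
  ∀ x ∈ I, ψ x ∈ idealTensor k A H I

/-- Coassociativity of the coaction `ψ`:
`(ψ ⊗ id_H) ∘ ψ = (id_A ⊗ Δ_H) ∘ ψ` as maps `A → A ⊗[k] H ⊗[k] H`. -/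
def IsCoassoc (ψ : A →ₐ[k] A ⊗[k] H) : Prop :=
  ∀ a : A,
    (TensorProduct.assoc k A H H)
        ((TensorProduct.map ψ.toLinearMap (LinearMap.id : H →ₗ[k] H)) (ψ a))
      = (TensorProduct.map (LinearMap.id : A →ₗ[k] A)
          (Coalgebra.comul (R := k) (A := H))) (ψ a)

/-- Counitality of the coaction `ψ`: `(id_A ⊗ ε_H) ∘ ψ = id_A` under the canonical
isomorphism `A ⊗[k] k ≅ A`. -/
def IsCounital (ψ : A →ₐ[k] A ⊗[k] H) : Prop :=
  ∀ a : A,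
    (TensorProduct.rid k A)
        ((TensorProduct.map (LinearMap.id : A →ₗ[k] A)
          (Coalgebra.counit (R := k) (A := H))) (ψ a)) = a

/-- The set `I* = {x ∈ I : ψ x ∈ I ⊗ H}`. -/
def starSet (ψ : A →ₐ[k] A ⊗[k] H) (I : Ideal A) : Set A :=
  {x : A | x ∈ I ∧ ψ x ∈ idealTensor k A H I}

/-- Slicing with a functional on the right factor. -/
noncomputable def sliceR {k : Type*} [Field k] {A : Type*} [CommRing A] [Algebra k A]
    {M : Type*} [AddCommGroup M] [Module k M] (f : M →ₗ[k] k) : A ⊗[k] M →ₗ[k] A :=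
  (TensorProduct.rid k A).toLinearMap ∘ₗ TensorProduct.map (LinearMap.id : A →ₗ[k] A) f

theorem sliceR_tmul {k : Type*} [Field k] {A : Type*} [CommRing A] [Algebra k A]
    {M : Type*} [AddCommGroup M] [Module k M] (f : M →ₗ[k] k) (a : A) (m : M) :
    sliceR f (a ⊗ₜ[k] m) = f m • a := by
  simp [sliceR]

theorem mem_idealTensor_iff (I : Ideal A) (t : A ⊗[k] H) :
    t ∈ idealTensor k A H I ↔ ∀ f : H →ₗ[k] k, sliceR f t ∈ I := by
  constructor
  · rintro ⟨u, rfl⟩ f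
    induction u using TensorProduct.induction_on with
    | zero => simp
    | tmul a h =>
      rw [TensorProduct.map_tmul, sliceR_tmul]
      exact (I.restrictScalars k).smul_mem _ a.2
    | add x y hx hy =>
      rw [map_add, map_add]
      exact I.add_mem hx hy
  · intro hf
    let b := Module.Basis.ofVectorSpace k H
    obtain ⟨c, hc⟩ := TensorProduct.eq_repr_basis_right b t
    have key : ∀ i, c i ∈ I := by
      intro i
      have h1 := hf (b.coord i)
      rw [← hc, Finsupp.sum, map_sum] at h1
      classical
      have h2 : ∑ j ∈ c.support, sliceR (b.coord i) (c j ⊗ₜ[k] b j) = c i := by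
        simp only [sliceR_tmul, Module.Basis.coord_apply, Module.Basis.repr_self,
          Finsupp.single_apply, ite_smul, one_smul, zero_smul]
        simp [eq_comm]
      rwa [h2] at h1
    rw [← hc]
    refine Submodule.sum_mem _ fun i _ => ?_
    exact ⟨(⟨c i, key i⟩ : I.restrictScalars k) ⊗ₜ b i, by simp⟩

theorem slice_slice (ψ : A →ₐ[k] A ⊗[k] H) (hco : IsCoassoc k A H ψ)
    (f g : H →ₗ[k] k) (x : A) :
    sliceR g (ψ (sliceR f (ψ x))) =
      sliceR ((LinearMap.mul' k k ∘ₗ TensorProduct.map g f) ∘ₗ Coalgebra.comul (R := k) (A := H))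
        (ψ x) := by
  have h1 : ∀ t : A ⊗[k] H, sliceR g (ψ (sliceR f t)) =
      sliceR (LinearMap.mul' k k ∘ₗ TensorProduct.map g f) ((TensorProduct.assoc k A H H)
        ((TensorProduct.map ψ.toLinearMap (LinearMap.id : H →ₗ[k] H)) t)) := by
    intro t
    induction t using TensorProduct.induction_on with
    | zero => simp
    | add x y hx hy => simp only [map_add, hx, hy]
    | tmul a h =>
      rw [sliceR_tmul, map_smul, map_smul, TensorProduct.map_tmul]
      simp only [AlgHom.toLinearMap_apply, LinearMap.id_apply]
      induction ψ a using TensorProduct.induction_on with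
      | zero => simp
      | add x y hx hy => simp only [map_add, smul_add, TensorProduct.add_tmul, hx, hy]
      | tmul b l => simp [sliceR_tmul, smul_smul, mul_comm]
  rw [h1, hco x]
  induction ψ x using TensorProduct.induction_on with
  | zero => simp
  | add x y hx hy => simp only [map_add, hx, hy]
  | tmul b l => simp [sliceR_tmul]

theorem mem_starSet_iff (ψ : A →ₐ[k] A ⊗[k] H) (hcu : IsCounital k A H ψ) (I : Ideal A) (x : A) :
    x ∈ starSet k A H ψ I ↔ ∀ f : H →ₗ[k] k, sliceR f (ψ x) ∈ I := by
  refine ⟨fun h => (mem_idealTensor_iff k A H I _).1 h.2, fun h =>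
    ⟨?_, (mem_idealTensor_iff k A H I _).2 h⟩⟩
  have h1 := h (Coalgebra.counit (R := k) (A := H))
  have h2 : sliceR (Coalgebra.counit (R := k) (A := H)) (ψ x) = x := hcu x
  rwa [h2] at h1

/-- assuming `p*` is prime for every prime `p`, the assignment `p ↦ p*`
defines a continuous map `r : Spec(A) → Spec^inv(A)` restricting to the identity on
`Spec^inv(A)`, and for every invariant ideal `I`, `r ⁻¹ (V^inv(I)) = V(I)`. -/
theorem stmt17 (ψ : A →ₐ[k] A ⊗[k] H)
    (hco : IsCoassoc k A H ψ) (hcu : IsCounital k A H ψ)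
    (hstar : ∀ p : Ideal A, p.IsPrime →
      ∃ q : Ideal A, (q : Set A) = starSet k A H ψ p ∧ q.IsPrime) :
    ∃ r : PrimeSpectrum A → {q : PrimeSpectrum A // IsInvariantIdeal k A H ψ q.asIdeal},
      Continuous r ∧
      (∀ p : PrimeSpectrum A, ((r p).1.asIdeal : Set A) = starSet k A H ψ p.asIdeal) ∧
      (∀ q : {q : PrimeSpectrum A // IsInvariantIdeal k A H ψ q.asIdeal}, r q.1 = q) ∧
      (∀ I : Ideal A, IsInvariantIdeal k A H ψ I →
        r ⁻¹' {p : {q : PrimeSpectrum A // IsInvariantIdeal k A H ψ q.asIdeal} |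
                I ≤ p.1.asIdeal}
          = {p : PrimeSpectrum A | I ≤ p.asIdeal}) := by
  choose q hq hqp using hstar
  have hmem : ∀ (p : PrimeSpectrum A) (x : A), x ∈ q p.asIdeal p.isPrime ↔
      ∀ f : H →ₗ[k] k, sliceR f (ψ x) ∈ p.asIdeal := fun p x => by
    rw [← mem_starSet_iff k A H ψ hcu, ← hq p.asIdeal p.isPrime, SetLike.mem_coe]
  have hinv : ∀ p : PrimeSpectrum A, IsInvariantIdeal k A H ψ (q p.asIdeal p.isPrime) := by
    intro p x hx
    rw [mem_idealTensor_iff]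
    intro f
    rw [hmem]
    intro g
    rw [slice_slice k A H ψ hco]
    exact (hmem p x).1 hx _
  refine ⟨fun p => ⟨⟨q p.asIdeal p.isPrime, hqp _ _⟩, hinv p⟩, ?_, fun p => hq _ _, ?_, ?_⟩
  · refine Continuous.subtype_mk ?_ _
    rw [continuous_iff_isClosed]
    intro s hs
    obtain ⟨s, rfl⟩ := (PrimeSpectrum.isClosed_iff_zeroLocus _).1 hs
    rw [PrimeSpectrum.isClosed_iff_zeroLocus]
    refine ⟨{y | ∃ x ∈ s, ∃ f : H →ₗ[k] k, sliceR f (ψ x) = y}, ?_⟩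
    ext p
    constructor
    · rintro h _ ⟨x, hx, f, rfl⟩
      exact (hmem p x).1 (h hx) f
    · intro h x hx
      exact (hmem p x).2 fun f => h ⟨x, hx, f, rfl⟩
  · intro p
    apply Subtype.ext
    apply PrimeSpectrum.ext
    ext x
    refine (hmem p.1 x).trans ?_
    rw [← mem_starSet_iff k A H ψ hcu]
    exact ⟨fun h => h.1, fun h => ⟨h, p.2 x h⟩⟩
  · intro I hI
    ext p
    constructor
    · intro h x hx
      have h1 : x ∈ (q p.asIdeal p.isPrime : Set A) := h hx
      rw [hq] at h1
      exact h1.1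
    · intro h x hx
      refine (hmem p x).2 fun f => h ?_
      exact (mem_idealTensor_iff k A H I _).1 (hI x hx) f
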